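/- Let u_N be a polynomial of degree at most N on [−1,1] and let α, β ∈ {0,1}. Then ∫_{−1}^1 u_N'(x)² (1−x)^α (1+x)^β dx ≥ c N^{−2} ∫_{−1}^1 u_N'(x)² dx for an absolute constant c > 0. -/

import Mathlib

open Polynomial

/-- Integration of real polynomials over `[-1, 1]`, as a linear functional. -/
noncomputable def integralFunctional : ℝ[X] →ₗ[ℝ] ℝ where
  toFun p := ∫ x in (-1:ℝ)..1, p.eval x
  map_add' p q := by
    simp only [eval_add]
    exact intervalIntegral.integral_add (p.continuous.intervalIntegrable _ _)
      (q.continuous.intervalIntegrable _ _)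
  map_smul' a p := by
    simp only [eval_smul, smul_eq_mul, RingHom.id_apply]
    exact intervalIntegral.integral_const_mul _ _

theorem integralFunctional_apply (p : ℝ[X]) :
    integralFunctional p = ∫ x in (-1:ℝ)..1, p.eval x := rfl

theorem integralFunctional_mono {p q : ℝ[X]}
    (h : ∀ x ∈ Set.Icc (-1:ℝ) 1, p.eval x ≤ q.eval x) :
    integralFunctional p ≤ integralFunctional q :=
  intervalIntegral.integral_mono_on (by norm_num) (p.continuous.intervalIntegrable _ _)
    (q.continuous.intervalIntegrable _ _) h

theorem integralFunctional_nonneg {p : ℝ[X]} (h : ∀ x ∈ Set.Icc (-1:ℝ) 1, 0 ≤ p.eval x) :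
    0 ≤ integralFunctional p := by
  simpa using integralFunctional_mono (p := 0) (by simpa using h)

theorem integralFunctional_derivative (p : ℝ[X]) :
    integralFunctional (derivative p) = p.eval 1 - p.eval (-1) :=
  intervalIntegral.integral_eq_sub_of_hasDerivAt (fun x _ => p.hasDerivAt x)
    ((derivative p).continuous.intervalIntegrable _ _)

theorem eq_zero_of_integralFunctional_mul_self {p : ℝ[X]} (h : integralFunctional (p * p) = 0) :
    p = 0 := by
  by_contra hp
  obtain ⟨x, hx, hpx⟩ : ∃ x ∈ Set.Icc (-1:ℝ) 1, p.eval x ≠ 0 := by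
    by_contra! hcon
    exact hp (p.eq_zero_of_infinite_isRoot ((Set.Icc_infinite (by norm_num)).mono hcon))
  have hpos : 0 < ∫ x in (-1:ℝ)..1, (p * p).eval x :=
    intervalIntegral.integral_pos (by norm_num) (p * p).continuous.continuousOn
      (fun y _ => by simpa using mul_self_nonneg (p.eval y))
      ⟨x, hx, by simpa using mul_self_pos.2 hpx⟩
  exact hpos.ne' h

/-- The `L²(-1, 1)` inner product on real polynomials. -/
noncomputable def polynomialInner : LinearMap.BilinForm ℝ ℝ[X] :=
  (LinearMap.mul ℝ ℝ[X]).compr₂ integralFunctional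

theorem exists_orthogonal_projection_degreeLT (n : ℕ) (p : ℝ[X]) :
    ∃ r ∈ degreeLT ℝ n, ∀ s ∈ degreeLT ℝ n, integralFunctional (s * (p - r)) = 0 := by
  have : FiniteDimensional ℝ (degreeLT ℝ n) := Module.Finite.equiv (degreeLTEquiv ℝ n).symm
  have hsep (q : degreeLT ℝ n) (hq : polynomialInner q q = 0) : q = 0 :=
    Subtype.ext (eq_zero_of_integralFunctional_mul_self hq)
  have hnondeg : (polynomialInner.restrict (degreeLT ℝ n)).Nondegenerate :=
    ⟨fun q hq => hsep q (hq q), fun q hq => hsep q (hq q)⟩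
  let f : Module.Dual ℝ (degreeLT ℝ n) := (polynomialInner p).domRestrict (degreeLT ℝ n)
  let r := (LinearMap.BilinForm.toDual _ hnondeg).symm f
  refine ⟨r, r.2, fun s hs => ?_⟩
  have h : integralFunctional (r * s) = integralFunctional (p * s) :=
    LinearMap.BilinForm.apply_toDual_symm_apply (hB := hnondeg) f ⟨s, hs⟩
  rw [mul_comm, sub_mul, map_sub, h, sub_self]

/-- The Legendre differential operator `p ↦ -((1 - x²) p')'`. -/
noncomputable def legendreOperator (p : ℝ[X]) : ℝ[X] :=
  -derivative ((1 - X ^ 2) * derivative p)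

theorem integralFunctional_mul_legendreOperator (p q : ℝ[X]) :
    integralFunctional (q * legendreOperator p) =
      integralFunctional ((1 - X ^ 2) * derivative q * derivative p) := by
  have h := integralFunctional_derivative (q * ((1 - X ^ 2) * derivative p))
  rw [derivative_mul, map_add] at h
  simp only [eval_mul, eval_sub, eval_one, eval_pow, eval_X] at h
  rw [legendreOperator, mul_neg, map_neg,
    show (1 - X ^ 2) * derivative q * derivative p =
      derivative q * ((1 - X ^ 2) * derivative p) by ring]
  linarith

theorem coeff_legendreOperator (p : ℝ[X]) (m : ℕ) :
    (legendreOperator p).coeff m =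
      m * (m + 1) * p.coeff m - (m + 1) * (m + 2) * p.coeff (m + 2) := by
  rw [legendreOperator, coeff_neg, coeff_derivative, sub_mul, one_mul, coeff_sub,
    coeff_X_pow_mul', coeff_derivative]
  rcases m with _ | k
  · simp
    ring
  · rw [if_pos (by omega), show k + 1 + 1 - 2 = k by omega, coeff_derivative]
    push_cast
    ring

theorem legendreOperator_mem_degreeLT {n : ℕ} {p : ℝ[X]} (hp : p ∈ degreeLT ℝ n) :
    legendreOperator p ∈ degreeLT ℝ n := by
  rw [mem_degreeLT, degree_lt_iff_coeff_zero] at *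
  intro m hm
  rw [coeff_legendreOperator, hp m hm, hp (m + 2) (by omega)]
  ring

theorem legendreOperator_sub_mem_degreeLT {n : ℕ} {p : ℝ[X]} (hp : p ∈ degreeLT ℝ (n + 1)) :
    legendreOperator p - C ((n : ℝ) * (n + 1)) * p ∈ degreeLT ℝ n := by
  rw [mem_degreeLT, degree_lt_iff_coeff_zero] at *
  intro m hm
  rw [coeff_sub, coeff_C_mul, coeff_legendreOperator, hp (m + 2) (by omega)]
  rcases hm.eq_or_lt with rfl | hlt
  · ring
  · rw [hp m hlt]
    ring

/-- A weighted Markov inequality, from the spectrum of the Legendre operator. -/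
theorem integralFunctional_derivative_sq_le (n : ℕ) :
    ∀ p ∈ degreeLT ℝ n, integralFunctional ((1 - X ^ 2) * derivative p * derivative p) ≤
      (n : ℝ) ^ 2 * integralFunctional (p * p) := by
  induction n with
  | zero =>
    intro p hp
    have : p = 0 := by simpa [mem_degreeLT] using hp
    simp [this]
  | succ n ih =>
    intro p hp
    obtain ⟨r, hr, horth⟩ := exists_orthogonal_projection_degreeLT n p
    obtain ⟨q, rfl⟩ : ∃ q, p = r + q := ⟨p - r, by ring⟩
    rw [add_sub_cancel_left] at horth
    have hr' : r ∈ degreeLT ℝ (n + 1) := degreeLT_mono n.le_succ hr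
    have hq' : q ∈ degreeLT ℝ (n + 1) := by
      simpa using Submodule.sub_mem _ hp hr'
    have hcross : integralFunctional ((1 - X ^ 2) * derivative r * derivative q) = 0 := by
      have h := horth _ (legendreOperator_mem_degreeLT hr)
      rw [mul_comm, integralFunctional_mul_legendreOperator] at h
      rw [← h]
      congr 1
      ring
    have heig : integralFunctional ((1 - X ^ 2) * derivative q * derivative q) =
        n * (n + 1) * integralFunctional (q * q) := by
      have h := horth _ (legendreOperator_sub_mem_degreeLT hq')
      rw [sub_mul, map_sub, mul_comm, integralFunctional_mul_legendreOperator, mul_assoc (C _),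
        ← smul_eq_C_mul, map_smul, smul_eq_mul] at h
      linarith
    have hsq : integralFunctional ((r + q) * (r + q)) =
        integralFunctional (r * r) + integralFunctional (q * q) := by
      rw [show (r + q) * (r + q) = r * r + (r * q + r * q) + q * q by ring]
      simp only [map_add, horth r hr]
      ring
    have hder : integralFunctional ((1 - X ^ 2) * derivative (r + q) * derivative (r + q)) =
        integralFunctional ((1 - X ^ 2) * derivative r * derivative r) +
          integralFunctional ((1 - X ^ 2) * derivative q * derivative q) := by
      rw [derivative_add, show (1 - X ^ 2) * (derivative r + derivative q) *
          (derivative r + derivative q) = (1 - X ^ 2) * derivative r * derivative r +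
          ((1 - X ^ 2) * derivative r * derivative q + (1 - X ^ 2) * derivative r * derivative q) +
          (1 - X ^ 2) * derivative q * derivative q by ring]
      simp only [map_add, hcross]
      ring
    have hrr : 0 ≤ integralFunctional (r * r) :=
      integralFunctional_nonneg fun x _ => by simpa using mul_self_nonneg (r.eval x)
    have hqq : 0 ≤ integralFunctional (q * q) :=
      integralFunctional_nonneg fun x _ => by simpa using mul_self_nonneg (q.eval x)
    have hn : (0 : ℝ) ≤ n := n.cast_nonneg
    rw [hsq, hder, heig]
    push_cast
    nlinarith [ih r hr, mul_nonneg hn hrr, mul_nonneg hn hqq]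

theorem integralFunctional_sq_le {n : ℕ} (hn : 1 ≤ n) {p : ℝ[X]} (hp : p ∈ degreeLT ℝ n) :
    integralFunctional (p * p) ≤ 4 * (n : ℝ) ^ 2 * integralFunctional ((1 - X ^ 2) * (p * p)) := by
  have hn2 : (1 : ℝ) ≤ (n : ℝ) ^ 2 := one_le_pow₀ (by exact_mod_cast hn)
  have hmarkov := integralFunctional_derivative_sq_le n p hp
  have hparts : 2 * integralFunctional (p * p) - 3 * integralFunctional ((1 - X ^ 2) * (p * p)) =
      integralFunctional (2 * X * (1 - X ^ 2) * p * derivative p) := by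
    have h := integralFunctional_derivative (X * (1 - X ^ 2) * (p * p))
    rw [show derivative (X * (1 - X ^ 2) * (p * p)) =
        (3 : ℝ) • ((1 - X ^ 2) * (p * p)) - (2 : ℝ) • (p * p) +
          2 * X * (1 - X ^ 2) * p * derivative p by
      simp only [derivative_mul, derivative_sub, derivative_X, derivative_one, derivative_X_pow,
        smul_eq_C_mul, map_ofNat, Nat.cast_ofNat]
      ring, map_add, map_sub, map_smul, map_smul] at h
    simp only [eval_mul, eval_sub, eval_one, eval_pow, eval_X, smul_eq_mul] at h
    linarith
  have hyoung : (n : ℝ) ^ 2 * integralFunctional (2 * X * (1 - X ^ 2) * p * derivative p) ≤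
      ((n : ℝ) ^ 2) ^ 2 * integralFunctional ((1 - X ^ 2) * (p * p)) +
        integralFunctional ((1 - X ^ 2) * derivative p * derivative p) := by
    rw [← smul_eq_mul (_ ^ 2) (integralFunctional _),
      ← smul_eq_mul (_ ^ 2) (integralFunctional _), ← map_smul, ← map_smul, ← map_add]
    refine integralFunctional_mono fun x hx => ?_
    simp only [eval_smul, eval_add, eval_mul, eval_sub, eval_one, eval_pow, eval_X, eval_ofNat,
      smul_eq_mul]
    have hw : 0 ≤ 1 - x ^ 2 := by nlinarith [hx.1, hx.2]
    nlinarith [mul_nonneg hw (sq_nonneg ((n : ℝ) ^ 2 * x * p.eval x - (derivative p).eval x)),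
      mul_nonneg hw (mul_nonneg hw (sq_nonneg ((n : ℝ) ^ 2 * p.eval x)))]
  have hw : 0 ≤ integralFunctional ((1 - X ^ 2) * (p * p)) :=
    integralFunctional_nonneg fun x hx => by
      simp only [eval_mul, eval_sub, eval_one, eval_pow, eval_X]
      exact mul_nonneg (by nlinarith [hx.1, hx.2]) (mul_self_nonneg _)
  rw [← hparts] at hyoung
  have key : 2 * integralFunctional (p * p) - 3 * integralFunctional ((1 - X ^ 2) * (p * p)) ≤
      (n : ℝ) ^ 2 * integralFunctional ((1 - X ^ 2) * (p * p)) + integralFunctional (p * p) :=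
    le_of_mul_le_mul_left (by linarith) (zero_lt_one.trans_le hn2)
  nlinarith

/-- For polynomials `u_N` of degree at most `N` and `α, β ∈ {0,1}`, the
weighted `H¹` seminorm controls the unweighted one up to a factor `N⁻²`:
`∫ u_N'(x)² (1−x)^α (1+x)^β dx ≥ c N⁻² ∫ u_N'(x)² dx` for an absolute constant
`c > 0`. -/
theorem weighted_seminorm_lower_bound :
    ∃ c : ℝ, 0 < c ∧
      ∀ (N : ℕ), 1 ≤ N → ∀ (u : Polynomial ℝ), u.natDegree ≤ N →
      ∀ α β : ℕ, (α = 0 ∨ α = 1) → (β = 0 ∨ β = 1) →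
        (∫ x in (-1:ℝ)..1, (u.derivative.eval x) ^ 2 * (1 - x) ^ α * (1 + x) ^ β)
          ≥ c / (N : ℝ) ^ 2 *
            ∫ x in (-1:ℝ)..1, (u.derivative.eval x) ^ 2 := by
  refine ⟨1 / 8, by norm_num, fun N hN u hu α β hα hβ => ?_⟩
  have hmem : derivative u ∈ degreeLT ℝ N := by
    rw [mem_degreeLT, degree_lt_iff_coeff_zero]
    intro m hm
    rw [coeff_derivative, coeff_eq_zero_of_natDegree_lt (by omega), zero_mul]
  have hmain := integralFunctional_sq_le hN hmem
  have hweight : (1 / 2 : ℝ) * integralFunctional ((1 - X ^ 2) * (derivative u * derivative u)) ≤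
      integralFunctional (derivative u ^ 2 * (1 - X) ^ α * (1 + X) ^ β) := by
    rw [← smul_eq_mul, ← map_smul]
    refine integralFunctional_mono fun x ⟨hx₁, hx₂⟩ => ?_
    simp only [eval_smul, eval_add, eval_mul, eval_sub, eval_one, eval_pow, eval_X, smul_eq_mul]
    have hle : 1 / 2 * (1 - x ^ 2) ≤ (1 - x) ^ α * (1 + x) ^ β := by
      rcases hα with rfl | rfl <;> rcases hβ with rfl | rfl <;> nlinarith
    nlinarith [mul_le_mul_of_nonneg_left hle (sq_nonneg ((derivative u).eval x))]
  have hN2 : (0 : ℝ) < (N : ℝ) ^ 2 := by positivity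
  simp only [integralFunctional_apply, ← sq, eval_add, eval_mul, eval_sub, eval_one, eval_pow,
    eval_X] at hmain hweight
  refine le_trans ?_ hweight
  rw [div_mul_eq_mul_div, div_le_iff₀ hN2]
  linarith
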